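/- arXiv:2301.09802 — 11 statements merged into one kernel-verified Lean document; each statement's English description precedes it below -/
import Mathlib

section
/- Let A be an ω-CPO with an algebraic-CPO presentation (incl, idl) over a partial order B, and let C be an ω-CPO. Then for every monotone function f : B →o C there exists a unique ω-continuous function F : A → C such that F (incl b) = f b for every b : B. -/
open OmegaCompletePartialOrder

/-- An algebraic-CPO presentation of the ω-CPO `A` over the partial order `B`:
an order embedding `incl : B ↪o A` and `idl : A → ℕ → B` such that `idl a` is
monotone, `a` is the least upper bound of `fun i => incl (idl a i)` (density),
and every basis element is compact. -/
structure AlgPres (B : Type*) (A : Type*) [PartialOrder B]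
    [OmegaCompletePartialOrder A] where
  incl : B ↪o A
  idl : A → ℕ → B
  idl_mono : ∀ a : A, Monotone (idl a)
  dense : ∀ a : A, IsLUB (Set.range fun i : ℕ => incl (idl a i)) a
  compact : ∀ (b : B) (c : Chain A), incl b ≤ ωSup c → ∃ i : ℕ, incl b ≤ c i

/-- `g` is ω-continuous: monotone, and it sends the least upper bound of every
ω-chain to the least upper bound of its image. -/
def OmegaCont {A C : Type*} [OmegaCompletePartialOrder A]
    [OmegaCompletePartialOrder C] (g : A → C) : Prop :=
  Monotone g ∧ ∀ c : Chain A, IsLUB (Set.range fun i : ℕ => g (c i)) (g (ωSup c))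

/-- The continuous extension of a monotone basis function `f`:
`coExt P f a = ωSup (fun i => f (idl a i))`. -/
def coExt {B A C : Type*} [PartialOrder B] [OmegaCompletePartialOrder A]
    [OmegaCompletePartialOrder C] (P : AlgPres B A) (f : B →o C) (a : A) : C :=
  ωSup ⟨fun i : ℕ => f (P.idl a i), fun _ _ h => f.monotone (P.idl_mono a h)⟩

theorem coExt_chain_sup {B A : Type*} [PartialOrder B] [OmegaCompletePartialOrder A]
    (P : AlgPres B A) (a : A) :
    a = ωSup (⟨fun i : ℕ => P.incl (P.idl a i),
      fun _ _ h => P.incl.monotone (P.idl_mono a h)⟩ : Chain A) :=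
  ωSup_eq_of_isLUB (P.dense a)

theorem coExt_le_of {B A C : Type*} [PartialOrder B] [OmegaCompletePartialOrder A]
    [OmegaCompletePartialOrder C] (P : AlgPres B A) (f : B →o C) (a : A) (x : C)
    (h : ∀ b, P.incl b ≤ a → f b ≤ x) : coExt P f a ≤ x :=
  ωSup_le _ _ fun i => h _ ((P.dense a).1 ⟨i, rfl⟩)

theorem le_coExt {B A C : Type*} [PartialOrder B] [OmegaCompletePartialOrder A]
    [OmegaCompletePartialOrder C] (P : AlgPres B A) (f : B →o C) (a : A) (b : B)
    (h : P.incl b ≤ a) : f b ≤ coExt P f a := by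
  obtain ⟨i, hi⟩ := P.compact b _ (h.trans (coExt_chain_sup P a).le)
  exact le_ωSup_of_le i (f.monotone (P.incl.le_iff_le.1 hi))

/-- Continuous extension: existence and uniqueness. -/
theorem continuous_extension {B A C : Type*} [PartialOrder B]
    [OmegaCompletePartialOrder A] [OmegaCompletePartialOrder C]
    (P : AlgPres B A) (f : B →o C) :
    ∃! F : A → C, OmegaCont F ∧ ∀ b : B, F (P.incl b) = f b := by
  have hm : Monotone (coExt P f) := fun a a' h =>
    coExt_le_of P f a _ fun b hb => le_coExt P f a' b (hb.trans h)
  refine ⟨coExt P f, ⟨⟨hm, fun c => ⟨?_, ?_⟩⟩, fun b => ?_⟩, ?_⟩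
  · rintro _ ⟨i, rfl⟩
    exact hm (le_ωSup c i)
  · intro x hx
    refine coExt_le_of P f _ _ fun b hb => ?_
    obtain ⟨i, hi⟩ := P.compact b c hb
    exact (le_coExt P f _ b hi).trans (hx ⟨i, rfl⟩)
  · exact le_antisymm
      (coExt_le_of P f _ _ fun b' hb => f.monotone (P.incl.le_iff_le.1 hb))
      (le_coExt P f _ b le_rfl)
  · rintro G ⟨⟨_, hG⟩, hGf⟩
    funext a
    have h := hG ⟨fun i : ℕ => P.incl (P.idl a i),
      fun _ _ h => P.incl.monotone (P.idl_mono a h)⟩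
    rw [← coExt_chain_sup P a] at h
    refine ωSup_eq_of_isLUB ?_
    have e : (fun i : ℕ => f (P.idl a i)) = fun i : ℕ => G (P.incl (P.idl a i)) :=
      funext fun i => (hGf _).symm
    change IsLUB (Set.range fun i : ℕ => f (P.idl a i)) (G a)
    rw [e]
    exact h
end

section
/- Let A be an ω-CPO with an algebraic-CPO presentation (incl, idl) over a partial order B, let C be an ω-CPO, and let f : B →o C be monotone. Then the continuous extension co f satisfies co f (incl b) = f b for every b : B. -/
open OmegaCompletePartialOrder

/-- The continuous extension agrees with `f` on basis elements. -/
theorem coExt_incl {B A C : Type*} [PartialOrder B]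
    [OmegaCompletePartialOrder A] [OmegaCompletePartialOrder C]
    (P : AlgPres B A) (f : B →o C) :
    ∀ b : B, coExt P f (P.incl b) = f b := by
  intro b
  apply le_antisymm
  · refine ωSup_le _ _ fun i => f.monotone ?_
    exact P.incl.le_iff_le.mp ((P.dense (P.incl b)).1 ⟨i, rfl⟩)
  · let c : Chain A := ⟨fun i : ℕ => P.incl (P.idl (P.incl b) i),
      fun _ _ h => P.incl.monotone (P.idl_mono _ h)⟩
    have hb : P.incl b ≤ ωSup c := by
      refine (P.dense (P.incl b)).2 ?_
      rintro _ ⟨i, rfl⟩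
      exact le_ωSup c i
    obtain ⟨i, hi⟩ := P.compact b c hb
    have hi' : b ≤ P.idl (P.incl b) i := P.incl.le_iff_le.mp hi
    exact (f.monotone hi').trans (le_ωSup (⟨fun i : ℕ => f (P.idl (P.incl b) i),
      fun _ _ h => f.monotone (P.idl_mono _ h)⟩ : Chain C) i)
end

section
/- Let A be an ω-CPO with an algebraic-CPO presentation (incl, idl) over a partial order B, let C be an ω-CPO, and let f : B →o C be monotone. Then the continuous extension co f is ω-continuous: co f is monotone, and for every ω-chain c : ℕ → A, co f (ωSup c) is the least upper bound of fun i => co f (c i). -/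
open OmegaCompletePartialOrder

/-- A basis element below `a` is sent below the extension at `a`. -/
theorem le_coExt_of_incl_le {B A C : Type*} [PartialOrder B]
    [OmegaCompletePartialOrder A] [OmegaCompletePartialOrder C]
    (P : AlgPres B A) (f : B →o C) {b : B} {a : A} (h : P.incl b ≤ a) :
    f b ≤ coExt P f a := by
  let d : Chain A := ⟨fun i : ℕ => P.incl (P.idl a i),
    fun _ _ h => P.incl.monotone (P.idl_mono a h)⟩
  have hd : a ≤ ωSup d := (P.dense a).2 (by
    rintro _ ⟨i, rfl⟩
    exact le_ωSup d i)
  obtain ⟨i, hi⟩ := P.compact b d (h.trans hd)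
  have hb : b ≤ P.idl a i := P.incl.le_iff_le.mp hi
  exact (f.monotone hb).trans (le_ωSup
    (⟨fun i : ℕ => f (P.idl a i), fun _ _ h => f.monotone (P.idl_mono a h)⟩ : Chain C) i)

/-- Continuous extensions are ω-continuous. -/
theorem coExt_continuous {B A C : Type*} [PartialOrder B]
    [OmegaCompletePartialOrder A] [OmegaCompletePartialOrder C]
    (P : AlgPres B A) (f : B →o C) :
    Monotone (coExt P f) ∧
      ∀ c : Chain A,
        IsLUB (Set.range fun i : ℕ => coExt P f (c i)) (coExt P f (ωSup c)) := by
  have hm : Monotone (coExt P f) := by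
    intro a a' h
    refine ωSup_le _ _ fun i => ?_
    exact le_coExt_of_incl_le P f (((P.dense a).1 ⟨i, rfl⟩).trans h)
  refine ⟨hm, fun c => ⟨?_, fun u hu => ?_⟩⟩
  · rintro _ ⟨i, rfl⟩
    exact hm (le_ωSup c i)
  · refine ωSup_le _ _ fun i => ?_
    obtain ⟨j, hj⟩ := P.compact (P.idl (ωSup c) i) c ((P.dense (ωSup c)).1 ⟨i, rfl⟩)
    exact (le_coExt_of_incl_le P f hj).trans (hu ⟨j, rfl⟩)
end

section
/- Let A be an ω-CPO with an algebraic-CPO presentation (incl, idl) over a partial order B, let C be an ω-CPO, and let f : B →o C be monotone. If g : A → C is ω-continuous and g (incl b) = f b for every b : B, then g = co f (pointwise equality g a = co f a for every a : A). -/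
open OmegaCompletePartialOrder

/-- Uniqueness of continuous extensions. -/
theorem coExt_unique {B A C : Type*} [PartialOrder B]
    [OmegaCompletePartialOrder A] [OmegaCompletePartialOrder C]
    (P : AlgPres B A) (f : B →o C) (g : A → C)
    (hg : OmegaCont g) (hgf : ∀ b : B, g (P.incl b) = f b) :
    ∀ a : A, g a = coExt P f a := by
  intro a
  let c : Chain A := ⟨fun i : ℕ => P.incl (P.idl a i),
    fun _ _ h => P.incl.monotone (P.idl_mono a h)⟩
  have hc : ωSup c = a := (isLUB_range_ωSup c).unique (P.dense a)
  have h1 := hg.2 c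
  rw [hc] at h1
  have h2 : (fun i : ℕ => g (c i)) = fun i : ℕ => f (P.idl a i) :=
    funext fun i => hgf (P.idl a i)
  rw [h2] at h1
  exact h1.unique (isLUB_range_ωSup
    (⟨fun i : ℕ => f (P.idl a i), fun _ _ h => f.monotone (P.idl_mono a h)⟩ : Chain C))
end

section
/- (Representation of continuous functions) Let A be an ω-CPO with an algebraic-CPO presentation (incl, idl) over a partial order B, let C be an ω-CPO, and let g : A → C be ω-continuous. Then g = co (g ∘ incl), i.e., g a = co (g ∘ incl) a for every a : A, where g ∘ incl : B →o C is monotone. -/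
open OmegaCompletePartialOrder

/-- Representation of continuous functions: `g = co (g ∘ incl)`. -/
theorem coExt_representation {B A C : Type*} [PartialOrder B]
    [OmegaCompletePartialOrder A] [OmegaCompletePartialOrder C]
    (P : AlgPres B A) (g : A → C) (hg : OmegaCont g) :
    ∀ a : A,
      g a =
        coExt P (⟨fun b => g (P.incl b),
          fun _ _ h => hg.1 (P.incl.monotone h)⟩ : B →o C) a := by
  intro a
  let c : Chain A :=
    ⟨fun i : ℕ => P.incl (P.idl a i), fun _ _ h => P.incl.monotone (P.idl_mono a h)⟩
  have hc : ωSup c = a := (isLUB_range_ωSup c).unique (P.dense a)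
  have h := hg.2 c
  rw [hc] at h
  exact h.unique (isLUB_range_ωSup (⟨fun i : ℕ => g (P.incl (P.idl a i)),
    fun _ _ h => hg.1 (P.incl.monotone (P.idl_mono a h))⟩ : Chain C))
end

section
/- (Cocontinuous extension) Let A be an ω-CPO with an algebraic-CPO presentation (incl, idl) over a partial order B. Let C be a partial order in which every antitone sequence ℕ → C has a greatest lower bound (i.e., the order dual of C is an ω-CPO), and let f : B → C be antitone. Then there exists a unique function G : A → C such that G (incl b) = f b for every b : B and G is ω-cocontinuous, meaning G is antitone and for every ω-chain c : ℕ → A, G (ωSup c) is the greatest lower bound of fun i => G (c i). -/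
open OmegaCompletePartialOrder

/-- Cocontinuous extension: existence and uniqueness. -/
theorem cocontinuous_extension {B A C : Type*} [PartialOrder B]
    [OmegaCompletePartialOrder A] [PartialOrder C]
    (hC : ∀ c : ℕ → C, Antitone c → ∃ x : C, IsGLB (Set.range c) x)
    (P : AlgPres B A) (f : B → C) (hf : Antitone f) :
    ∃! G : A → C,
      (∀ b : B, G (P.incl b) = f b) ∧
        Antitone G ∧
          ∀ c : Chain A,
            IsGLB (Set.range fun i : ℕ => G (c i)) (G (ωSup c)) := by
  have chain_eq : ∀ a : A, ∃ c : Chain A, (∀ i, c i = P.incl (P.idl a i)) ∧ ωSup c = a := by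
    intro a
    refine ⟨⟨fun i => P.incl (P.idl a i), fun _ _ h => P.incl.monotone (P.idl_mono a h)⟩,
      fun _ => rfl, ?_⟩
    exact (isLUB_range_ωSup _).unique (P.dense a)
  choose G hG using fun a : A => hC (fun i => f (P.idl a i)) (fun _ _ h => hf (P.idl_mono a h))
  have lower : ∀ (a : A) (b : B), P.incl b ≤ a → G a ≤ f b := by
    intro a b hb
    obtain ⟨c, hc, hs⟩ := chain_eq a
    obtain ⟨i, hi⟩ := P.compact b c (hs.symm ▸ hb)
    rw [hc i] at hi
    exact ((hG a).1 ⟨i, rfl⟩).trans (hf (P.incl.le_iff_le.1 hi))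
  have idl_le : ∀ (a : A) (i : ℕ), P.incl (P.idl a i) ≤ a := fun a i => (P.dense a).1 ⟨i, rfl⟩
  have greatest : ∀ (a : A) (x : C), (∀ b, P.incl b ≤ a → x ≤ f b) → x ≤ G a := by
    intro a x hx
    refine (hG a).2 ?_
    rintro _ ⟨i, rfl⟩
    exact hx _ (idl_le a i)
  have anti : Antitone G := fun a a' h => greatest a _ fun b hb => lower a' b (hb.trans h)
  refine ⟨G, ⟨fun b => ?_, anti, fun c => ⟨?_, ?_⟩⟩, ?_⟩
  · exact le_antisymm (lower _ b le_rfl)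
      (greatest _ _ fun b' hb' => hf (P.incl.le_iff_le.1 hb'))
  · rintro _ ⟨i, rfl⟩
    exact anti (le_ωSup c i)
  · intro x hx
    refine greatest _ _ fun b hb => ?_
    obtain ⟨i, hi⟩ := P.compact b c hb
    exact (hx ⟨i, rfl⟩).trans (lower _ b hi)
  · rintro H ⟨hH, -, hcont⟩
    funext a
    obtain ⟨c, hc, hs⟩ := chain_eq a
    have h := hcont c
    simp only [hc, hH, hs] at h
    exact h.unique (hG a)
end

section
/- (Compactness of finite lists among streams) Let l : List α, let c : ℕ → Stream'.Seq α be monotone with respect to the prefix order, and let u : Stream'.Seq α be a least upper bound of the range of c in the prefix order. If Stream'.Seq.ofList l ≤ u in the prefix order, then there exists i : ℕ with Stream'.Seq.ofList l ≤ c i. -/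
/-- The prefix order on possibly-infinite sequences:
`s ≤ t` iff wherever `s` is defined, `t` takes the same value. -/
instance seqPrefixOrder {α : Type*} : PartialOrder (Stream'.Seq α) where
  le s t := ∀ (n : ℕ) (a : α), s.get? n = some a → t.get? n = some a
  le_refl _ _ _ h := h
  le_trans _ _ _ h1 h2 n a h := h2 n a (h1 n a h)
  le_antisymm s t h1 h2 := by
    apply Stream'.Seq.ext
    intro n
    cases hs : s.get? n with
    | none =>
      cases ht : t.get? n with
      | none => rfl
      | some a => exact absurd (h2 n a ht) (by simp [hs])
    | some a => exact (h1 n a hs).symm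

/-- Compactness of finite lists among streams. -/
theorem ofList_compact {α : Type*} (l : List α) (c : ℕ → Stream'.Seq α)
    (hc : Monotone c) (u : Stream'.Seq α) (hu : IsLUB (Set.range c) u)
    (hl : Stream'.Seq.ofList l ≤ u) :
    ∃ i : ℕ, Stream'.Seq.ofList l ≤ c i := by
  have hle : ∀ s t : Stream'.Seq α, s ≤ t ↔
      ∀ (n : ℕ) (a : α), s.get? n = some a → t.get? n = some a := fun _ _ => Iff.rfl
  have hub : ∀ i, c i ≤ u := fun i => hu.1 ⟨i, rfl⟩
  by_cases h0 : l.length = 0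
  · refine ⟨0, (hle _ _).2 fun n a h => ?_⟩
    rw [List.length_eq_zero_iff.1 h0] at h
    simp at h
  obtain ⟨N, hN⟩ : ∃ N, l.length = N + 1 := ⟨l.length - 1, by omega⟩
  have key : ∃ i b, (c i).get? N = some b := by
    by_contra hcon
    push Not at hcon
    let v : Stream'.Seq α := ⟨fun k => if k < N then u.get? k else none, by
      intro k hk
      change (if k < N then u.get? k else none) = none at hk
      change (if k + 1 < N then u.get? (k + 1) else none) = none
      split_ifs with h
      · rw [if_pos (by omega)] at hk
        exact u.le_stable (Nat.le_succ k) hk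
      · rfl⟩
    have hv : ∀ k, v.get? k = if k < N then u.get? k else none := fun _ => rfl
    have huv : u ≤ v := by
      apply hu.2
      rintro _ ⟨i, rfl⟩
      refine (hle _ _).2 fun k a hk => ?_
      rw [hv]
      by_cases hkN : k < N
      · rw [if_pos hkN]
        exact (hle _ _).1 (hub i) k a hk
      · obtain ⟨b, hb⟩ := (c i).ge_stable (not_lt.1 hkN) hk
        exact absurd hb (hcon i b)
    have h1 : u.get? N = some (l[N]'(by omega)) :=
      (hle _ _).1 hl N _ (by rw [Stream'.Seq.ofList_get?]; exact List.getElem?_eq_getElem _)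
    have h2 := (hle _ _).1 huv N _ h1
    rw [hv] at h2
    simp at h2
  obtain ⟨i, b, hb⟩ := key
  refine ⟨i, (hle _ _).2 fun k a hk => ?_⟩
  have hkl : k < l.length := by
    rw [Stream'.Seq.ofList_get?] at hk
    exact (List.getElem?_eq_some_iff.1 hk).1
  obtain ⟨d, hd⟩ := (c i).ge_stable (show k ≤ N by omega) hb
  have h1 := (hle _ _).1 (hub i) k d hd
  have h2 := (hle _ _).1 hl k a hk
  rw [hd, ← h1, h2]
end

section
/- (Cofold computation rule) Let β be a partial order with least element ⊥, and let f : α → β → β be such that for each a : α, f a is monotone and preserves least upper bounds of monotone sequences (if u is a least upper bound of the range of a monotone c : ℕ → β, then f a u is a least upper bound of the range of fun i => f a (c i)). Let a : α and s : Stream'.Seq α. If u is a least upper bound in β of the range of n ↦ List.foldr f ⊥ ((Stream'.Seq.cons a s).take n), and v is a least upper bound in β of the range of n ↦ List.foldr f ⊥ (s.take n), then u = f a v. -/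
/-- Cofold computation rule. -/
theorem cofold_cons {α β : Type*} [PartialOrder β] [OrderBot β]
    (f : α → β → β)
    (hmono : ∀ a : α, Monotone (f a))
    (hcont : ∀ (a : α) (c : ℕ → β), Monotone c → ∀ u : β,
      IsLUB (Set.range c) u → IsLUB (Set.range fun i : ℕ => f a (c i)) (f a u))
    (a : α) (s : Stream'.Seq α) (u v : β)
    (hu : IsLUB
      (Set.range fun n : ℕ => List.foldr f ⊥ ((Stream'.Seq.cons a s).take n)) u)
    (hv : IsLUB (Set.range fun n : ℕ => List.foldr f ⊥ (s.take n)) v) :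
    u = f a v := by
  have hstep : ∀ (n : ℕ) (t : Stream'.Seq α),
      List.foldr f ⊥ (t.take n) ≤ List.foldr f ⊥ (t.take (n + 1)) := by
    intro n
    induction n with
    | zero => intro t; simp
    | succ n ih =>
      intro t
      induction t using Stream'.Seq.recOn with
      | nil => simp
      | cons x t =>
        simp only [Stream'.Seq.take_succ_cons, List.foldr_cons]
        exact hmono x (ih t)
  have hf := hcont a _ (monotone_nat_of_le_succ fun n => hstep n s) v hv
  apply le_antisymm
  · apply hu.2
    rintro _ ⟨n, rfl⟩
    cases n with
    | zero => simp
    | succ n =>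
      simp only [Stream'.Seq.take_succ_cons, List.foldr_cons]
      exact hf.1 ⟨n, rfl⟩
  · apply hf.2
    rintro _ ⟨n, rfl⟩
    apply hu.1
    exact ⟨n + 1, by simp⟩
end

section
/- (Soundness of the sieve of Eratosthenes) Let S : Set ℕ satisfy: for every n : ℕ, n ∈ S ↔ (2 ≤ n ∧ ∀ m ∈ S, m < n → ¬ (m ∣ n)). Then every element of S is prime: ∀ n ∈ S, Nat.Prime n. -/
/-- Soundness of the sieve of Eratosthenes: every number emitted by the
sieve is prime. -/
theorem sieve_sound (S : Set ℕ)
    (hS : ∀ n : ℕ, n ∈ S ↔ 2 ≤ n ∧ ∀ m ∈ S, m < n → ¬ (m ∣ n)) :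
    ∀ n ∈ S, Nat.Prime n := by
  have hp : ∀ p : ℕ, p.Prime → p ∈ S := by
    intro p pp
    refine (hS p).2 ⟨pp.two_le, fun m hm hlt hd => ?_⟩
    have h2 := ((hS m).1 hm).1
    rcases (Nat.dvd_prime pp).1 hd with h | h <;> omega
  intro n hn
  obtain ⟨h2, h⟩ := (hS n).1 hn
  have hpr : n.minFac.Prime := Nat.minFac_prime (by omega)
  have hle : n.minFac ≤ n := Nat.minFac_le (by omega)
  rcases hle.lt_or_eq with hlt | heq
  · exact absurd (Nat.minFac_dvd n) (h _ (hp _ hpr) hlt)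
  · rw [← heq]
    exact hpr
end

section
/- (Completeness of the sieve of Eratosthenes) Let S : Set ℕ satisfy: for every n : ℕ, n ∈ S ↔ (2 ≤ n ∧ ∀ m ∈ S, m < n → ¬ (m ∣ n)). Then every prime number belongs to S: ∀ n, Nat.Prime n → n ∈ S. -/
/-- Completeness of the sieve of Eratosthenes: every prime number is
emitted by the sieve. -/
theorem sieve_complete (S : Set ℕ)
    (hS : ∀ n : ℕ, n ∈ S ↔ 2 ≤ n ∧ ∀ m ∈ S, m < n → ¬ (m ∣ n)) :
    ∀ n : ℕ, Nat.Prime n → n ∈ S := by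
  intro n hn
  refine (hS n).2 ⟨hn.two_le, fun m hm hlt hdvd => ?_⟩
  have h2 := ((hS m).1 hm).1
  rcases (Nat.dvd_prime hn).1 hdvd with h | h <;> omega
end

section
/- (Commutativity of stream filtering) Let f, g : α → Bool and s : Stream'.Seq α. For h : α → Bool and x, y : Stream'.Seq α, say that y is the h-filtrate of x if y is a least upper bound, in the prefix order, of the range of n ↦ Stream'.Seq.ofList (List.filter h (x.take n)). Suppose t₁ is the g-filtrate of s, t₂ is the f-filtrate of t₁, u₁ is the f-filtrate of s, and u₂ is the g-filtrate of u₁. Then t₂ = u₂. -/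
/-- `y` is the `h`-filtrate of `x`: `y` is a least upper bound of the
filtered finite prefixes of `x`. -/
def IsFiltrate {α : Type*} (h : α → Bool) (x y : Stream'.Seq α) : Prop :=
  IsLUB (Set.range fun n : ℕ => Stream'.Seq.ofList (List.filter h (x.take n))) y

theorem ofList_le_take {α : Type*} (l : List α) (t : Stream'.Seq α)
    (h : Stream'.Seq.ofList l ≤ t) : t.take l.length = l := by
  apply List.ext_getElem?
  intro k
  rw [Stream'.Seq.getElem?_take]
  split_ifs with hk
  · have := h k l[k] (by simp [hk])
    rw [this]; simp [hk]
  · simp at hk; simp [hk]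

theorem ofList_mono {α : Type*} {l l' : List α} (h : l <+: l') :
    Stream'.Seq.ofList l ≤ Stream'.Seq.ofList l' := by
  obtain ⟨r, rfl⟩ := h
  intro n a hn
  rw [Stream'.Seq.ofList_get?] at hn ⊢
  have hl : n < l.length := (List.getElem?_eq_some_iff.mp hn).1
  rw [List.getElem?_append_left hl]; exact hn

theorem filtrate_reach {α : Type*} {g : α → Bool} {s t : Stream'.Seq α}
    (h : IsFiltrate g s t) (k : ℕ) (a : α) (hk : t.get? k = some a) :
    ∃ m, k < (List.filter g (s.take m)).length := by
  by_contra hc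
  push Not at hc
  have hle : t ≤ Stream'.Seq.ofList (t.take k) := by
    apply h.2
    rintro _ ⟨m, rfl⟩ n b hn
    have h2 := h.1 ⟨m, rfl⟩ n b hn
    simp only [Stream'.Seq.ofList_get?] at hn
    have hl := (List.getElem?_eq_some_iff.mp hn).1
    have := hc m
    rw [Stream'.Seq.ofList_get?, Stream'.Seq.getElem?_take, if_pos (by omega)]
    exact h2
  have := hle k a hk
  rw [Stream'.Seq.ofList_get?, Stream'.Seq.getElem?_take] at this
  simp at this

theorem filtrate_take_prefix {α : Type*} {g : α → Bool} {s t : Stream'.Seq α}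
    (h : IsFiltrate g s t) (n : ℕ) :
    ∃ m, t.take n <+: List.filter g (s.take m) := by
  rcases Nat.eq_zero_or_pos (t.take n).length with h0 | h0
  · exact ⟨0, by rw [List.length_eq_zero_iff.mp h0]; exact List.nil_prefix⟩
  · have hlt : (t.take n).length - 1 < (t.take n).length := by omega
    have h1 := List.getElem?_eq_getElem hlt
    have hn : (t.take n).length ≤ n := Stream'.Seq.length_take_le
    rw [Stream'.Seq.getElem?_take, if_pos (by omega)] at h1
    obtain ⟨m, hm⟩ := filtrate_reach h _ _ h1
    refine ⟨m, ?_⟩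
    rw [List.prefix_iff_getElem?]
    intro k hk
    have h2 := h.1 ⟨m, rfl⟩ k (List.filter g (s.take m))[k] (by simp)
    have h3 := List.getElem?_eq_getElem hk
    rw [Stream'.Seq.getElem?_take, if_pos (by omega), h2] at h3
    rw [← h3]; simp

theorem filtrate_comp {α : Type*} {f g : α → Bool} {s t u : Stream'.Seq α}
    (h1 : IsFiltrate g s t) (h2 : IsFiltrate f t u) :
    IsFiltrate (fun a => f a && g a) s u := by
  constructor
  · rintro _ ⟨n, rfl⟩
    have := ofList_le_take _ _ (h1.1 ⟨n, rfl⟩)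
    simp only
    rw [← List.filter_filter, ← this]
    exact h2.1 ⟨_, rfl⟩
  · intro c hc
    apply h2.2
    rintro _ ⟨n, rfl⟩
    obtain ⟨m, hm⟩ := filtrate_take_prefix h1 n
    refine le_trans (ofList_mono (hm.filter f)) ?_
    rw [List.filter_filter]
    exact hc ⟨m, rfl⟩

/-- Commutativity of stream filtering. -/
theorem filtrate_comm {α : Type*} (f g : α → Bool) (s t₁ t₂ u₁ u₂ : Stream'.Seq α)
    (h1 : IsFiltrate g s t₁) (h2 : IsFiltrate f t₁ t₂)
    (h3 : IsFiltrate f s u₁) (h4 : IsFiltrate g u₁ u₂) :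
    t₂ = u₂ := by
  have h5 := filtrate_comp h1 h2
  have h6 := filtrate_comp h3 h4
  simp only [Bool.and_comm (g _) (f _)] at h6
  exact h5.unique h6
end
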